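/- Let D₁ be the split graph with vertex set {1,2,3,4,5,6} ∪ {a,b,c,d}, in which {1,2,3,4,5,6} induces a complete graph, {a,b,c,d} is an independent set, and the remaining edges are exactly: a adjacent to 1, 3, 5; b adjacent to 1, 2; c adjacent to 3, 4; d adjacent to 5, 6. Then there is no bijection σ from {1,2,3,4,5,6} to {1,…,6} such that for every vertex v ∈ {a,b,c,d}, the image under σ of the neighborhood N(v) ⊆ {1,2,3,4,5,6} is either an interval [p, q] = {p, p+1, …, q} with p ≤ q, or a set of the form [1, p] ∪ [q, 6] with p < q. -/

import Mathlib

/-- Neighborhoods in the clique `{1,…,6}` (represented by `Fin 6`, with vertex `i+1`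
represented by `i`) of the independent vertices `a, b, c, d` (represented by `Fin 4`):
`a` is adjacent to `1,3,5`; `b` to `1,2`; `c` to `3,4`; `d` to `5,6`. -/
def D1nbr : Fin 4 → Finset (Fin 6)
  | 0 => {0, 2, 4}
  | 1 => {0, 1}
  | 2 => {2, 3}
  | 3 => {4, 5}

/-- The split graph `D₁`: the clique `{1,…,6}` (as `Fin 6`), the independent set
`{a,b,c,d}` (as `Fin 4`), and edges between them given by `D1nbr`. -/
def D1 : SimpleGraph (Fin 6 ⊕ Fin 4) :=
  SimpleGraph.fromRel fun u v =>
    match u, v with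
    | Sum.inl _, Sum.inl _ => True
    | Sum.inl i, Sum.inr a => i ∈ D1nbr a
    | _, _ => False

/-- The cyclic successor on `{1, …, 6}`. -/
def cyclicSucc (x : ℕ) : ℕ := if x = 6 then 1 else x + 1

theorem cyclicSucc_injOn : Set.InjOn cyclicSucc (Set.Icc 1 6) := by
  intro x hx y hy h
  simp only [cyclicSucc, Set.mem_Icc] at *
  split_ifs at h <;> omega

/-- A cyclic interval of `{1, …, 6}` is left by the cyclic successor from at most one point. -/
theorem eq_of_cyclicSucc_notMem {S : Set ℕ}
    (hS : (∃ p q : ℕ, 1 ≤ p ∧ p ≤ q ∧ q ≤ 6 ∧ S = Set.Icc p q) ∨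
      (∃ p q : ℕ, 1 ≤ p ∧ p < q ∧ q ≤ 6 ∧ S = Set.Icc 1 p ∪ Set.Icc q 6))
    {x y : ℕ} (hx : x ∈ S) (hy : y ∈ S) (hx' : cyclicSucc x ∉ S) (hy' : cyclicSucc y ∉ S) :
    x = y := by
  rcases hS with ⟨p, q, hp, hpq, hq, rfl⟩ | ⟨p, q, hp, hpq, hq, rfl⟩ <;>
  · simp only [cyclicSucc, Set.mem_union, Set.mem_Icc] at *
    split_ifs at hx' hy' <;> omega

theorem D1_adj_inr_inl (a : Fin 4) (i : Fin 6) :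
    D1.Adj (Sum.inr a) (Sum.inl i) ↔ i ∈ D1nbr a := by
  simp [D1]

/-- There is no bijective labeling `σ` of the clique vertices of `D₁` by `{1,…,6}` such
that the labels of the neighborhood of each independent vertex form an interval
`[p,q]` with `p ≤ q`, or a set `[1,p] ∪ [q,6]` with `p < q`. -/
theorem stmt16 :
    ¬ ∃ σ : Fin 6 → ℕ, Set.BijOn σ Set.univ (Set.Icc 1 6) ∧
      ∀ a : Fin 4,
        (∃ p q : ℕ, 1 ≤ p ∧ p ≤ q ∧ q ≤ 6 ∧
          σ '' {i : Fin 6 | D1.Adj (Sum.inr a) (Sum.inl i)} = Set.Icc p q) ∨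
        (∃ p q : ℕ, 1 ≤ p ∧ p < q ∧ q ≤ 6 ∧
          σ '' {i : Fin 6 | D1.Adj (Sum.inr a) (Sum.inl i)} =
            Set.Icc 1 p ∪ Set.Icc q 6) := by
  rintro ⟨σ, hσ, h⟩
  have hexit : ∀ a : Fin 4, ∀ i ∈ D1nbr a, ∀ j ∈ D1nbr a, i ≠ j →
      (∃ k ∈ D1nbr a, σ k = cyclicSucc (σ i)) ∨ ∃ k ∈ D1nbr a, σ k = cyclicSucc (σ j) := by
    intro a i hi j hj hij
    by_contra! hne
    have ha := h a
    simp only [D1_adj_inr_inl] at ha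
    refine hij (hσ.injOn (Set.mem_univ i) (Set.mem_univ j)
      (eq_of_cyclicSucc_notMem ha ⟨i, hi, rfl⟩ ⟨j, hj, rfl⟩ ?_ ?_))
    · rintro ⟨k, hk, hki⟩
      exact hne.1 k hk hki
    · rintro ⟨k, hk, hkj⟩
      exact hne.2 k hk hkj
  have hfix : ∀ i, σ i ≠ cyclicSucc (σ i) := by
    intro i
    unfold cyclicSucc
    split_ifs <;> omega
  have hb := hexit 1 0 (by decide) 1 (by decide) (by decide)
  have hc := hexit 2 2 (by decide) 3 (by decide) (by decide)
  have hd := hexit 3 4 (by decide) 5 (by decide) (by decide)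
  have h02 := hexit 0 0 (by decide) 2 (by decide) (by decide)
  have h04 := hexit 0 0 (by decide) 4 (by decide) (by decide)
  have h24 := hexit 0 2 (by decide) 4 (by decide) (by decide)
  simp only [D1nbr, Finset.mem_insert, Finset.mem_singleton, exists_eq_or_imp,
    exists_eq_left, hfix, false_or, or_false] at hb hc hd h02 h04 h24
  have hne : ∀ i j k, i ≠ j → σ k = cyclicSucc (σ i) → σ k ≠ cyclicSucc (σ j) :=
    fun i j k hij hi hj => hij (hσ.injOn (Set.mem_univ i) (Set.mem_univ j)
      (cyclicSucc_injOn (hσ.mapsTo (Set.mem_univ i)) (hσ.mapsTo (Set.mem_univ j))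
        (hi.symm.trans hj)))
  grind
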